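/- arXiv:1506.01169 — 2 statements merged into one kernel-verified Lean document; each statement's English description precedes it below -/
import Mathlib

section
/- Let P̂ be a polynomial with integer coefficients such that P̂(0) = 0 and deg P̂ ≥ 1. Then there exists n₀ ∈ ℕ such that, setting q = |P̂(n₀+2)|, one has q > 2 and P̂(n₀) is not congruent to P̂(n₀+2) modulo 2q. -/
open Filter in
theorem Polynomial.tendsto_abs_eval_natCast_atTop {P : Polynomial ℤ} (hdeg : 1 ≤ P.natDegree) :
    Tendsto (fun n : ℕ => |P.eval (n : ℤ)|) atTop atTop := by
  rw [← tendsto_intCast_atTop_iff (R := ℝ)]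
  have hdeg' : 0 < (P.map (Int.castRingHom ℝ)).degree := by
    rw [Polynomial.degree_map_eq_of_injective (RingHom.injective_int _)]
    exact Polynomial.natDegree_pos_iff_degree_pos.mp hdeg
  refine ((Polynomial.abs_tendsto_atTop _ hdeg').comp tendsto_natCast_atTop_atTop).congr fun n => ?_
  have h := Polynomial.eval_intCast_map (Int.castRingHom ℝ) P n
  simp_all

/-- For every integer polynomial `P̂` with `P̂(0) = 0` and `deg P̂ ≥ 1` there exists
`n₀ ∈ ℕ` such that, with `q = |P̂(n₀+2)|`, one has `q > 2` and
`P̂(n₀) ≢ P̂(n₀+2) (mod 2q)`. -/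
theorem exists_noncongruent_values
    (P : Polynomial ℤ) (h0 : P.eval 0 = 0) (hdeg : 1 ≤ P.natDegree) :
    ∃ n₀ : ℕ, 2 < |P.eval ((n₀ : ℤ) + 2)| ∧
      ¬ (P.eval (n₀ : ℤ) ≡ P.eval ((n₀ : ℤ) + 2) [ZMOD (2 * |P.eval ((n₀ : ℤ) + 2)|)]) := by
  have hP := Polynomial.tendsto_abs_eval_natCast_atTop hdeg
  by_contra! hcongr
  obtain ⟨N, hN⟩ := (hP.eventually_gt_atTop 2).exists_forall_of_atTop
  have hstep (n : ℕ) (hn : N ≤ n) : |P.eval ((n + 2 : ℕ) : ℤ)| ≤ |P.eval (n : ℤ)| := by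
    have hlarge := hN (n + 2) (by lia)
    push_cast at hlarge ⊢
    have hdvd_sub := (abs_dvd _ _).mp ((Dvd.intro_left 2 rfl).trans (hcongr n hlarge).dvd)
    have hdvd : P.eval ((n : ℤ) + 2) ∣ P.eval (n : ℤ) := (dvd_sub_right dvd_rfl).mp hdvd_sub
    exact Int.le_of_dvd (by linarith [hN n hn]) ((abs_dvd_abs _ _).mpr hdvd)
  have hbounded (k : ℕ) : |P.eval ((N + 2 * k : ℕ) : ℤ)| ≤ |P.eval (N : ℤ)| := by
    induction k with
    | zero => simp
    | succ k ih => exact (hstep (N + 2 * k) (by lia)).trans ih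
  obtain ⟨M, hM⟩ := (hP.eventually_gt_atTop |P.eval (N : ℤ)|).exists_forall_of_atTop
  exact (hM (N + 2 * M) (by lia)).not_ge (hbounded M)
end

section
/- For every open set U ⊆ ℂ containing the real line ℝ there exists an open set V with ℝ ⊆ V ⊆ U such that V is star-shaped with respect to 0, i.e. t·z ∈ V whenever z ∈ V and t ∈ [0,1]. -/
/-- The set of points whose segment to `0` stays in a given open set is open. -/
theorem isOpen_setOf_segment_subset {U : Set ℂ} (hU : IsOpen U) :
    IsOpen {z : ℂ | ∀ t ∈ Set.Icc (0 : ℝ) 1, (t : ℂ) * z ∈ U} := by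
  refine isOpen_iff_mem_nhds.2 fun z hz => ?_
  refine isCompact_Icc.eventually_forall_of_forall_eventually fun t ht => ?_
  have hc : Continuous fun p : ℂ × ℝ => (p.2 : ℂ) * p.1 := by fun_prop
  exact (hU.preimage hc).mem_nhds (hz t ht)

/-- Every open set `U ⊆ ℂ` containing the real line contains an open set `V` which
still contains the real line and is star-shaped with respect to `0`. -/
theorem exists_starshaped_neighborhood_of_real_line
    (U : Set ℂ) (hU : IsOpen U) (hRU : ∀ x : ℝ, (x : ℂ) ∈ U) :
    ∃ V : Set ℂ, IsOpen V ∧ (∀ x : ℝ, (x : ℂ) ∈ V) ∧ V ⊆ U ∧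
      ∀ z ∈ V, ∀ t : ℝ, t ∈ Set.Icc (0 : ℝ) 1 → (t : ℂ) * z ∈ V := by
  refine ⟨_, isOpen_setOf_segment_subset hU, fun x t _ => ?_, fun z hz => ?_,
    fun z hz t ht s hs => ?_⟩
  · exact_mod_cast hRU (t * x)
  · simpa using hz 1 (by simp)
  · have h := hz (s * t) ⟨mul_nonneg hs.1 ht.1, mul_le_one₀ hs.2 ht.1 ht.2⟩
    rwa [Complex.ofReal_mul, mul_assoc] at h
end
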